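/- Let n, k : ℕ and let L₁, L₂ be Submodules of (Fin n → ℂ) with finrank ℂ L₁ = finrank ℂ L₂ = k. Suppose that L₁ and L₂ have the same Plücker support: for every subset I of Fin n with #I = k, the I-th Plücker coordinate of L₁ is nonzero if and only if the I-th Plücker coordinate of L₂ is nonzero. Then L₁ and L₂ have the same stabilizer for the torus action: for every t : Fin n → ℂˣ, t • L₁ = L₁ if and only if t • L₂ = L₂. (All points of a stratum W_σ of G_{n,k} have the same stabilizer ℂ*_σ ⊂ (ℂˣ)ⁿ.) -/

import Mathlib

open Module

/-- The `I`-th Plücker coordinate of a `k`-dimensional subspace `L ⊆ ℂⁿ` (`#I = k`) is nonzero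
iff the coordinate projection onto the coordinates in `I` restricts to a linear isomorphism of
`L` onto `I → ℂ`, i.e. iff the corresponding `k × k` minor of a basis matrix of `L` is nonzero. -/
def PluckerNonzero {n : ℕ} (L : Submodule ℂ (Fin n → ℂ)) (I : Finset (Fin n)) : Prop :=
  Function.Bijective ((LinearMap.funLeft ℂ ℂ (fun i : I => (i : Fin n))).comp L.subtype)

/-- The linear automorphism of `ℂⁿ` given by an element `t` of the torus `(ℂˣ)ⁿ`:
`v ↦ (i ↦ t i * v i)`. -/
noncomputable def tMap {n : ℕ} (t : Fin n → ℂˣ) : (Fin n → ℂ) →ₗ[ℂ] (Fin n → ℂ) :=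
  LinearMap.pi fun i => (t i : ℂ) • LinearMap.proj i

lemma aux_inj_iff {n : ℕ} (L : Submodule ℂ (Fin n → ℂ)) (I : Finset (Fin n)) :
    Function.Injective ((LinearMap.funLeft ℂ ℂ (fun i : I => (i : Fin n))).comp L.subtype) ↔
    ∀ v ∈ L, (∀ i ∈ I, v i = 0) → v = 0 := by
  rw [injective_iff_map_eq_zero]
  constructor
  · intro h v hv hI
    have := h ⟨v, hv⟩ (by ext i; exact hI i i.2)
    simpa using this
  · rintro h ⟨v, hv⟩ hI
    have := h v hv (fun i hi => congrFun hI ⟨i, hi⟩)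
    simpa using this

lemma aux_pl_iff {n : ℕ} (L : Submodule ℂ (Fin n → ℂ)) (I : Finset (Fin n))
    (hc : I.card = finrank ℂ L) :
    PluckerNonzero L I ↔ ∀ v ∈ L, (∀ i ∈ I, v i = 0) → v = 0 := by
  rw [← aux_inj_iff]
  constructor
  · exact fun h => h.1
  · intro h
    refine ⟨h, ?_⟩
    exact (LinearMap.injective_iff_surjective_of_finrank_eq_finrank (by simp [hc])).1 h

lemma aux_dual {n : ℕ} (L : Submodule ℂ (Fin n → ℂ)) (I : Finset (Fin n))
    (h : PluckerNonzero L I) (w : Fin n → ℂ) : ∃ e ∈ L, ∀ i ∈ I, e i = w i := by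
  obtain ⟨⟨e, he⟩, hh⟩ := h.2 (fun i => w i)
  exact ⟨e, he, fun i hi => congrFun hh ⟨i, hi⟩⟩

lemma aux_exists {n : ℕ} (L : Submodule ℂ (Fin n → ℂ)) :
    ∃ I : Finset (Fin n), I.card = finrank ℂ L ∧ PluckerNonzero L I := by
  classical
  let P : Finset (Fin n) → Prop := fun I => ∀ v ∈ L, (∀ i ∈ I, v i = 0) → v = 0
  have hex : ∃ I, P I := ⟨Finset.univ, fun v _ h => funext fun i => h i (Finset.mem_univ i)⟩
  obtain ⟨I, hI⟩ := exists_minimal_of_wellFoundedLT P hex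
  have hinj := (aux_inj_iff L I).2 hI.1
  have hb : PluckerNonzero L I := by
    refine ⟨hinj, ?_⟩
    rw [← LinearMap.range_eq_top, eq_top_iff, ← (Pi.basisFun ℂ I).span_eq, Submodule.span_le]
    rintro _ ⟨⟨i, hi⟩, rfl⟩
    have hnot : ¬ P (I.erase i) := fun hP =>
      Finset.notMem_erase i I (hI.2 hP (Finset.erase_subset i I) hi)
    simp only [P] at hnot
    push Not at hnot
    obtain ⟨v, hv, hv0, hne⟩ := hnot
    have hvi : v i ≠ 0 := by
      intro h0
      refine hne (hI.1 v hv fun j hj => ?_)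
      by_cases hji : j = i
      · rw [hji, h0]
      · exact hv0 j (Finset.mem_erase.2 ⟨hji, hj⟩)
    refine ⟨(v i)⁻¹ • ⟨v, hv⟩, ?_⟩
    ext ⟨j, hj⟩
    by_cases hji : j = i
    · subst hji
      simp [LinearMap.funLeft_apply, hvi]
    · simp [LinearMap.funLeft_apply, hji, hv0 j (Finset.mem_erase.2 ⟨hji, hj⟩)]
  refine ⟨I, ?_, hb⟩
  have := (LinearEquiv.ofBijective _ hb).finrank_eq
  simpa using this.symm

lemma aux_tMap {n : ℕ} (t : Fin n → ℂˣ) (v : Fin n → ℂ) (i : Fin n) :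
    tMap t v i = (t i : ℂ) * v i := by simp [tMap]

lemma aux_stable {n : ℕ} (t : Fin n → ℂˣ) (L : Submodule ℂ (Fin n → ℂ)) :
    Submodule.map (tMap t) L = L ↔ ∀ v ∈ L, tMap t v ∈ L := by
  constructor
  · intro h v hv
    have := Submodule.mem_map_of_mem (f := tMap t) hv
    rwa [h] at this
  · intro h
    have hi : Function.Injective (tMap t) := by
      intro v w hvw
      ext i
      have := congrFun hvw i
      simpa [aux_tMap] using this
    refine Submodule.eq_of_le_of_finrank_eq (Submodule.map_le_iff_le_comap.2 h) ?_
    exact (Submodule.equivMapOfInjective (tMap t) hi L).finrank_eq.symm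

lemma aux_key {n : ℕ} (t : Fin n → ℂˣ) (L : Submodule ℂ (Fin n → ℂ)) (I : Finset (Fin n))
    (hc : I.card = finrank ℂ L) (hI : PluckerNonzero L I) :
    Submodule.map (tMap t) L = L ↔
      ∀ i ∈ I, ∀ j, j ∉ I → PluckerNonzero L (insert j (I.erase i)) → t i = t j := by
  classical
  have hinj := (aux_pl_iff L I hc).1 hI
  rw [aux_stable]
  constructor
  · intro hs i hi j hj hP
    obtain ⟨e, he, hd⟩ := aux_dual L I hI (Pi.single i 1)
    have hei : e i = 1 := by simp [hd i hi]
    have hek : ∀ k ∈ I, k ≠ i → e k = 0 := fun k hk hki => by simp [hd k hk, hki]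
    have hej : e j ≠ 0 := by
      intro h0
      have : e = 0 := by
        refine (aux_inj_iff L _).1 hP.1 e he fun k hk => ?_
        rcases Finset.mem_insert.1 hk with rfl | hk
        · exact h0
        · exact hek k (Finset.mem_of_mem_erase hk) (Finset.ne_of_mem_erase hk)
      rw [this] at hei
      simp at hei
    have hz := hinj (tMap t e - (t i : ℂ) • e) (L.sub_mem (hs e he) (L.smul_mem _ he)) (by
      intro k hk
      by_cases hki : k = i
      · subst hki; simp [aux_tMap]
      · simp [aux_tMap, hek k hk hki])
    have hzj := congrFun hz j
    simp only [Pi.sub_apply, aux_tMap, Pi.smul_apply, smul_eq_mul, Pi.zero_apply] at hzj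
    rw [← sub_mul] at hzj
    have := (mul_eq_zero.1 hzj).resolve_right hej
    exact Units.ext (sub_eq_zero.1 this).symm
  · intro hcond v hv
    have hex : ∀ i : Fin n, ∃ e ∈ L, ∀ k ∈ I, e k = (Pi.single i 1 : Fin n → ℂ) k :=
      fun i => aux_dual L I hI _
    choose e he hd using hex
    have hsum : v = ∑ i ∈ I, v i • e i := by
      rw [← sub_eq_zero]
      refine hinj _ (L.sub_mem hv (L.sum_mem fun i _ => L.smul_mem _ (he i))) fun k hk => ?_
      have : ∑ i ∈ I, v i * e i k = v k := by
        rw [Finset.sum_eq_single_of_mem k hk]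
        · simp [hd k k hk]
        · intro b _ hbk
          simp [hd b k hk, hbk.symm]
      simp [Finset.sum_apply, this]
    rw [hsum, map_sum]
    refine L.sum_mem fun i hi => ?_
    rw [map_smul]
    refine L.smul_mem _ ?_
    have hte : tMap t (e i) = (t i : ℂ) • e i := by
      ext j
      rw [aux_tMap, Pi.smul_apply, smul_eq_mul]
      by_cases hj : j ∈ I
      · by_cases hji : j = i
        · rw [hji]
        · simp [hd i j hj, hji]
      · by_cases h0 : e i j = 0
        · simp [h0]
        · rw [hcond i hi j hj]
          have hcard : (insert j (I.erase i)).card = finrank ℂ L := by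
            rw [Finset.card_insert_of_notMem (fun h => hj (Finset.mem_of_mem_erase h)),
              Finset.card_erase_add_one hi, hc]
          rw [aux_pl_iff L _ hcard]
          intro w hw hw0
          have hwe : w = w i • e i := by
            rw [← sub_eq_zero]
            refine hinj _ (L.sub_mem hw (L.smul_mem _ (he i))) fun k hk => ?_
            by_cases hki : k = i
            · subst hki; simp [hd k k hk]
            · simp [hd i k hk, hki,
                hw0 k (Finset.mem_insert_of_mem (Finset.mem_erase.2 ⟨hki, hk⟩))]
          have hwj := congrFun hwe j
          rw [hw0 j (Finset.mem_insert_self _ _), Pi.smul_apply, smul_eq_mul] at hwj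
          have hwi := (mul_eq_zero.1 hwj.symm).resolve_right h0
          rw [hwe, hwi, zero_smul]
    rw [hte]
    exact L.smul_mem _ (he i)

/-- Two `k`-dimensional subspaces of `ℂⁿ` with the same pattern of nonvanishing Plücker
coordinates (i.e. belonging to the same stratum of `G_{n,k}`) have the same stabilizer for the
canonical action of the algebraic torus `(ℂˣ)ⁿ`. -/
theorem same_stratum_same_stabilizer (n k : ℕ)
    (L₁ L₂ : Submodule ℂ (Fin n → ℂ))
    (h₁ : finrank ℂ L₁ = k) (h₂ : finrank ℂ L₂ = k)
    (hsupp : ∀ I : Finset (Fin n), I.card = k → (PluckerNonzero L₁ I ↔ PluckerNonzero L₂ I)) :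
    ∀ t : Fin n → ℂˣ, Submodule.map (tMap t) L₁ = L₁ ↔ Submodule.map (tMap t) L₂ = L₂ := by
  classical
  intro t
  obtain ⟨I, hc, hI⟩ := aux_exists L₁
  have hk : I.card = k := hc.trans h₁
  rw [aux_key t L₁ I hc hI, aux_key t L₂ I (hk.trans h₂.symm) ((hsupp I hk).1 hI)]
  refine forall_congr' fun i => forall_congr' fun hi => forall_congr' fun j =>
    forall_congr' fun hj => ?_
  rw [hsupp]
  rw [Finset.card_insert_of_notMem (fun h => hj (Finset.mem_of_mem_erase h)),
    Finset.card_erase_add_one hi, hk]
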